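/- Let q be an odd prime power and E ⊆ F_q^2 with |E| ≥ C q^{2 − 1/(k+1)} for a sufficiently large constant C. Then the number of equivalence classes of (k+1)-tuples from E — where tuples x and y are equivalent iff x^i·(x^j)^⊥ = y^i·(y^j)^⊥ for all pairs i,j — is at least c · q^{2k−1} for a constant c > 0 depending only on k. -/

import Mathlib

open Finset Matrix

section AreaCounting

variable {F : Type} [Field F]

/-- The area form `x · y^⊥` on the plane, up to sign. -/
def area (x y : Fin 2 → F) : F := x 0 * y 1 - x 1 * y 0

lemma area_mulVec (g : SpecialLinearGroup (Fin 2) F) (x y : Fin 2 → F) :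
    area (g.1 *ᵥ x) (g.1 *ᵥ y) = area x y := by
  have h := g.2
  rw [Matrix.det_fin_two] at h
  simp only [area, Matrix.mulVec, dotProduct, Fin.sum_univ_two]
  linear_combination (x 0 * y 1 - x 1 * y 0) * h

lemma exists_area_eq_one {x : Fin 2 → F} (hx : x ≠ 0) : ∃ x', area x x' = 1 := by
  by_cases h0 : x 0 = 0
  · have h1 : x 1 ≠ 0 := fun h1 => hx (by ext i; fin_cases i <;> simp [h0, h1])
    exact ⟨![-(x 1)⁻¹, 0], by simp [area, h1]⟩
  · exact ⟨![0, (x 0)⁻¹], by simp [area, h0]⟩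

/-- A vector is determined by its areas with two independent vectors. -/
lemma eq_of_area_eq {x x' z w : Fin 2 → F} (h : area x x' ≠ 0)
    (h1 : area x z = area x w) (h2 : area x' z = area x' w) : z = w := by
  simp only [area] at *
  ext i
  apply mul_left_cancel₀ h
  fin_cases i
  · simp only [Fin.zero_eta]
    linear_combination x' 0 * h1 - x 0 * h2
  · simp only [Fin.mk_one]
    linear_combination x' 1 * h1 - x 1 * h2

lemma specialLinearGroup_ext_of_mulVec {x x' : Fin 2 → F} (h : area x x' ≠ 0)
    {g g' : SpecialLinearGroup (Fin 2) F} (h1 : g.1 *ᵥ x = g'.1 *ᵥ x)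
    (h2 : g.1 *ᵥ x' = g'.1 *ᵥ x') : g = g' := by
  apply Subtype.ext
  apply Matrix.ext
  intro i j
  have e1 := congrFun h1 i
  have e2 := congrFun h2 i
  simp only [Matrix.mulVec, dotProduct, Fin.sum_univ_two] at e1 e2
  simp only [area] at h
  apply mul_left_cancel₀ h
  fin_cases j
  · simp only [Fin.zero_eta]
    linear_combination x' 1 * e1 - x 1 * e2
  · simp only [Fin.mk_one]
    linear_combination x 0 * e2 - x' 0 * e1

/-- The special linear group is transitive on pairs of vectors of a given nonzero area. -/
lemma exists_mulVec_eq {x x' y y' : Fin 2 → F} (h : area x x' ≠ 0)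
    (hy : area y y' = area x x') :
    ∃ g : SpecialLinearGroup (Fin 2) F, g.1 *ᵥ x = y ∧ g.1 *ᵥ x' = y' := by
  have h' := h
  simp only [area] at h' hy
  refine ⟨⟨(area x x')⁻¹ • !![x' 1 * y 0 - x 1 * y' 0, x 0 * y' 0 - x' 0 * y 0;
    x' 1 * y 1 - x 1 * y' 1, x 0 * y' 1 - x' 0 * y 1], ?_⟩, ?_, ?_⟩
  · rw [Matrix.det_smul, Matrix.det_fin_two]
    simp only [area, Fintype.card_fin, Matrix.of_apply, Matrix.cons_val', Matrix.cons_val_zero,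
      Matrix.cons_val_one, Matrix.cons_val_fin_one]
    field_simp
    linear_combination (x 0 * x' 1 - x 1 * x' 0) * hy
  · rw [Matrix.smul_mulVec, inv_smul_eq_iff₀ h]
    ext i
    fin_cases i <;>
    · simp [area, Matrix.mulVec, dotProduct, Fin.sum_univ_two]
      ring
  · rw [Matrix.smul_mulVec, inv_smul_eq_iff₀ h]
    ext i
    fin_cases i <;>
    · simp [area, Matrix.mulVec, dotProduct, Fin.sum_univ_two]
      ring

variable [DecidableEq F]

/-- Pairs of points of `E` spanning area `t`. -/
def areaPairs (E : Finset (Fin 2 → F)) (t : F) : Finset ((Fin 2 → F) × (Fin 2 → F)) :=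
  {p ∈ E ×ˢ E | area p.1 p.2 = t}

/-- Points of `E` spanning area `t` with `x`. -/
def areaLine (E : Finset (Fin 2 → F)) (x : Fin 2 → F) (t : F) : Finset (Fin 2 → F) :=
  {y ∈ E | area x y = t}

lemma card_areaPairs (E : Finset (Fin 2 → F)) (t : F) :
    #(areaPairs E t) = ∑ x ∈ E, #(areaLine E x t) := by
  simp only [areaPairs, areaLine, Finset.card_filter, Finset.sum_product]

variable [Fintype F]

lemma card_area_eq_le {x : Fin 2 → F} (hx : x ≠ 0) (t : F) :
    #{z : Fin 2 → F | area x z = t} ≤ Fintype.card F := by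
  obtain ⟨x', hx'⟩ := exists_area_eq_one hx
  rw [← Finset.card_univ]
  refine Finset.card_le_card_of_injOn (area x') (by simp) ?_
  intro z hz w hw hzw
  simp only [coe_filter, mem_univ, true_and, Set.mem_ofPred_eq] at hz hw
  exact eq_of_area_eq (by rw [hx']; exact one_ne_zero) (hz.trans hw.symm) hzw

lemma card_mulVec_eq_le {x : Fin 2 → F} (hx : x ≠ 0) (y : Fin 2 → F) :
    #{g : SpecialLinearGroup (Fin 2) F | g.1 *ᵥ x = y} ≤ Fintype.card F := by
  obtain ⟨x', hx'⟩ := exists_area_eq_one hx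
  by_cases hy : y = 0
  · rw [Finset.card_eq_zero.mpr]
    · exact Nat.zero_le _
    · refine Finset.filter_eq_empty_iff.mpr fun g _ hg => ?_
      have := area_mulVec g x x'
      rw [hg, hy, hx'] at this
      simp [area] at this
  · refine le_trans (Finset.card_le_card_of_injOn (fun g => g.1 *ᵥ x') ?_ ?_)
      (card_area_eq_le hy 1)
    · intro g hg
      simp only [coe_filter, mem_univ, true_and, Set.mem_ofPred_eq] at hg ⊢
      rw [← hg, area_mulVec, hx']
    · intro g hg g' hg' h
      simp only [coe_filter, mem_univ, true_and, Set.mem_ofPred_eq] at hg hg'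
      exact specialLinearGroup_ext_of_mulVec (by rw [hx']; exact one_ne_zero)
        (hg.trans hg'.symm) h

lemma card_le_card_mulVec_eq {x y : Fin 2 → F} (hx : x ≠ 0) (hy : y ≠ 0) :
    Fintype.card F ≤ #{g : SpecialLinearGroup (Fin 2) F | g.1 *ᵥ x = y} := by
  obtain ⟨x', hx'⟩ := exists_area_eq_one hx
  obtain ⟨y', hy'⟩ := exists_area_eq_one hy
  have key : ∀ s : F, ∃ g : SpecialLinearGroup (Fin 2) F,
      g.1 *ᵥ x = y ∧ g.1 *ᵥ x' = y' + s • y := by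
    intro s
    refine exists_mulVec_eq (by rw [hx']; exact one_ne_zero) ?_
    rw [hx', ← hy']
    simp only [area, Pi.add_apply, Pi.smul_apply, smul_eq_mul]
    ring
  choose f hf using key
  rw [← Finset.card_univ]
  refine Finset.card_le_card_of_injOn f
    (fun s _ => Finset.mem_coe.mpr (Finset.mem_filter.mpr ⟨Finset.mem_univ _, (hf s).1⟩)) ?_
  intro s _ s' _ h
  have h2 := (hf s).2
  rw [h, (hf s').2, add_right_inj] at h2
  exact (smul_left_injective F hy h2).symm

lemma card_specialLinearGroup_le :
    Fintype.card (SpecialLinearGroup (Fin 2) F) ≤ Fintype.card F ^ 3 := by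
  obtain ⟨x, hx⟩ := exists_ne (0 : Fin 2 → F)
  have h := Finset.card_le_mul_card_image_of_maps_to
    (s := (univ : Finset (SpecialLinearGroup (Fin 2) F))) (t := (univ : Finset (Fin 2 → F)))
    (f := fun g : SpecialLinearGroup (Fin 2) F => g.1 *ᵥ x) (fun _ _ => Finset.mem_univ _)
    (Fintype.card F)
    (fun y _ => card_mulVec_eq_le hx y)
  have hc : #(univ : Finset (Fin 2 → F)) = Fintype.card F ^ 2 := by
    rw [Finset.card_univ, Fintype.card_fun, Fintype.card_fin]
  rw [hc, Finset.card_univ] at h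
  exact h.trans_eq (pow_succ' _ 2).symm

/-- Points of `E` that the matrix `g` sends to `E`. -/
def stay (E : Finset (Fin 2 → F)) (g : SpecialLinearGroup (Fin 2) F) : Finset (Fin 2 → F) :=
  {x ∈ E | g.1 *ᵥ x ∈ E}

lemma card_mul_sq_le_sum_card_stay {E : Finset (Fin 2 → F)} (hE : 0 ∉ E) :
    Fintype.card F * #E ^ 2 ≤ ∑ g, #(stay E g) := by
  have h1 : ∀ g, #(stay E g) = ∑ x ∈ E, ∑ y ∈ E, if g.1 *ᵥ x = y then 1 else 0 := by
    intro g
    rw [stay, Finset.card_filter]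
    exact Finset.sum_congr rfl fun x _ => (Finset.sum_ite_eq E (g.1 *ᵥ x) fun _ => 1).symm
  simp_rw [h1]
  rw [Finset.sum_comm]
  simp_rw [Finset.sum_comm (s := univ), ← Finset.card_filter]
  calc Fintype.card F * #E ^ 2 = ∑ x ∈ E, ∑ y ∈ E, Fintype.card F := by
        simp; ring
    _ ≤ _ := Finset.sum_le_sum fun x hx => Finset.sum_le_sum fun y hy =>
        card_le_card_mulVec_eq (ne_of_mem_of_not_mem hx hE) (ne_of_mem_of_not_mem hy hE)

lemma sum_card_stay_sq_le {E : Finset (Fin 2 → F)} (hE : 0 ∉ E) :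
    ∑ g, #(stay E g) ^ 2 ≤ ∑ t, #(areaPairs E t) ^ 2 + Fintype.card F ^ 2 * #E ^ 2 := by
  let S : Finset (SpecialLinearGroup (Fin 2) F × (Fin 2 → F) × (Fin 2 → F)) :=
    {p | p.2.1 ∈ stay E p.1 ∧ p.2.2 ∈ stay E p.1}
  have hS : ∑ g, #(stay E g) ^ 2 = #S := by
    rw [Finset.card_eq_sum_card_fiberwise (f := Prod.fst) (t := univ) (by simp)]
    refine Finset.sum_congr rfl fun g _ => ?_
    rw [sq, ← Finset.card_product]
    refine Finset.card_bij (fun p _ => (g, p)) ?_ ?_ ?_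
    · intro p hp; simpa [S] using hp
    · intro p _ p' _ h; simpa using h
    · rintro ⟨g', p⟩ hp
      simp only [S, mem_filter, mem_univ, true_and] at hp
      obtain ⟨hp, rfl⟩ := hp
      exact ⟨p, by simpa using hp, rfl⟩
  rw [hS, ← Finset.card_filter_add_card_filter_not (s := S) (fun p => area p.2.1 p.2.2 ≠ 0)]
  refine Nat.add_le_add ?_ ?_
  · have : ∑ t, #(areaPairs E t) ^ 2 = #(univ.sigma fun t => areaPairs E t ×ˢ areaPairs E t) := by
      simp [sq]
    rw [this]
    refine Finset.card_le_card_of_injOn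
      (fun p => ⟨area p.2.1 p.2.2, p.2, (p.1.1 *ᵥ p.2.1, p.1.1 *ᵥ p.2.2)⟩) ?_ ?_
    · rintro ⟨g, x, x'⟩ hp
      simp only [S, stay, coe_filter, mem_filter, mem_univ, true_and, Set.mem_ofPred_eq] at hp
      simp only [areaPairs, coe_sigma, Set.mem_sigma_iff, mem_coe, mem_univ, mem_product,
        mem_filter, area_mulVec, hp, and_self]
    · rintro ⟨g, x, x'⟩ hp ⟨h, z, z'⟩ hq he
      simp only [S, stay, coe_filter, mem_filter, mem_univ, true_and, Set.mem_ofPred_eq] at hp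
      simp only [Sigma.mk.injEq, heq_eq_eq, Prod.mk.injEq] at he
      obtain ⟨_, ⟨rfl, rfl⟩, h1, h2⟩ := he
      rw [specialLinearGroup_ext_of_mulVec hp.2 h1 h2]
  · have := Finset.card_le_mul_card_image_of_maps_to
      (s := {p ∈ S | ¬ area p.2.1 p.2.2 ≠ 0}) (t := E ×ˢ E)
      (f := fun p => (p.2.1, p.1.1 *ᵥ p.2.1)) ?_ (Fintype.card F ^ 2) ?_
    · rwa [Finset.card_product, ← sq] at this
    · rintro ⟨g, x, x'⟩ hp
      simp only [S, stay, mem_filter, mem_univ, true_and] at hp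
      exact Finset.mem_product.mpr ⟨hp.1.1.1, hp.1.1.2⟩
    · rintro ⟨x, y⟩ hxy
      have hx : x ≠ 0 := ne_of_mem_of_not_mem (Finset.mem_product.mp hxy).1 hE
      refine le_trans ?_ ((Nat.mul_le_mul (card_mulVec_eq_le hx y) (card_area_eq_le hx 0)).trans_eq
        (sq _).symm)
      rw [← Finset.card_product]
      refine Finset.card_le_card_of_injOn (fun p => (p.1, p.2.2)) ?_ ?_
      · rintro ⟨g, z, z'⟩ hp
        simp only [coe_filter, mem_filter, Set.mem_ofPred_eq, Prod.mk.injEq, not_not] at hp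
        obtain ⟨⟨_, h⟩, rfl, h'⟩ := hp
        simp only [coe_product, Set.mem_prod, mem_coe, mem_filter, mem_univ, true_and]
        exact ⟨h', h⟩
      · rintro ⟨g, z, z'⟩ hp ⟨h, w, w'⟩ hq he
        simp only [coe_filter, mem_filter, Set.mem_ofPred_eq, Prod.mk.injEq] at hp hq he
        simp only [Prod.mk.injEq]
        exact ⟨he.1, hp.2.1.trans hq.2.1.symm, he.2⟩

lemma sum_card_areaLine (E : Finset (Fin 2 → F)) (x : Fin 2 → F) :
    ∑ t, #(areaLine E x t) = #E :=
  (Finset.card_eq_sum_card_fiberwise (by simp)).symm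

lemma sum_card_areaLine_sq_le (E : Finset (Fin 2 → F)) :
    ∑ x, ∑ t, #(areaLine E x t) ^ 2 ≤ Fintype.card F ^ 2 * #E + Fintype.card F * #E ^ 2 := by
  have h1 : ∀ x, ∑ t, #(areaLine E x t) ^ 2 =
      ∑ y ∈ E, ∑ y' ∈ E, if area x y = area x y' then 1 else 0 := by
    intro x
    simp only [areaLine, Finset.card_filter, sq, Finset.sum_mul_sum]
    rw [Finset.sum_comm]
    refine Finset.sum_congr rfl fun y _ => ?_
    rw [Finset.sum_comm]
    refine Finset.sum_congr rfl fun y' _ => ?_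
    simp [eq_comm]
  simp_rw [h1]
  rw [Finset.sum_comm]
  simp_rw [Finset.sum_comm (s := univ), ← Finset.card_filter]
  have h2 : ∀ y y' : Fin 2 → F, #{x : Fin 2 → F | area x y = area x y'} ≤
      (if y = y' then Fintype.card F ^ 2 else 0) + Fintype.card F := by
    intro y y'
    split_ifs with h
    · refine le_add_right ((Finset.card_le_univ _).trans_eq ?_)
      simp
    · rw [zero_add]
      refine le_trans (Finset.card_le_card ?_) (card_area_eq_le (sub_ne_zero.mpr h) 0)
      intro x hx
      rw [mem_filter] at hx ⊢
      refine ⟨mem_univ _, ?_⟩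
      have hx := hx.2
      simp only [area, Pi.sub_apply] at hx ⊢
      linear_combination -hx
  refine (Finset.sum_le_sum fun y _ => Finset.sum_le_sum fun y' _ => h2 y y').trans_eq ?_
  simp only [Finset.sum_add_distrib, Finset.sum_ite_eq, Finset.sum_const, smul_eq_mul,
    Finset.sum_ite_mem, Finset.inter_self]
  ring

lemma sum_sq_sub_areaLine_le (E : Finset (Fin 2 → F)) :
    ∑ x, ∑ t, ((#(areaLine E x t) : ℝ) - #E / Fintype.card F) ^ 2 ≤
      (Fintype.card F : ℝ) ^ 2 * #E := by
  have hq : (Fintype.card F : ℝ) ≠ 0 := by exact_mod_cast Fintype.card_ne_zero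
  have h1 : ∀ x, ∑ t, ((#(areaLine E x t) : ℝ) - #E / Fintype.card F) ^ 2 =
      ∑ t, (#(areaLine E x t) : ℝ) ^ 2 - (#E : ℝ) ^ 2 / Fintype.card F := by
    intro x
    have h := sum_card_areaLine E x
    have h' : ∑ t, (#(areaLine E x t) : ℝ) = #E := by exact_mod_cast h
    simp only [sub_sq, Finset.sum_add_distrib, Finset.sum_sub_distrib, ← Finset.sum_mul,
      ← Finset.mul_sum, h', Finset.sum_const, Finset.card_univ, nsmul_eq_mul]
    field_simp
    ring
  have h2 : ∑ x, ∑ t, (#(areaLine E x t) : ℝ) ^ 2 ≤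
      (Fintype.card F : ℝ) ^ 2 * #E + Fintype.card F * (#E : ℝ) ^ 2 := by
    exact_mod_cast sum_card_areaLine_sq_le E
  simp only [h1, Finset.sum_sub_distrib, Finset.sum_const, Finset.card_univ, nsmul_eq_mul,
    Fintype.card_fun, Fintype.card_fin, Nat.cast_pow]
  have h3 : (Fintype.card F : ℝ) ^ 2 * ((#E : ℝ) ^ 2 / Fintype.card F) =
      Fintype.card F * (#E : ℝ) ^ 2 := by field_simp
  linarith

lemma sum_card_areaPairs_sq_le (E : Finset (Fin 2 → F)) :
    ∑ t, (#(areaPairs E t) : ℝ) ^ 2 ≤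
      (#E : ℝ) ^ 4 / Fintype.card F + (Fintype.card F : ℝ) ^ 2 * (#E : ℝ) ^ 2 := by
  have hq : (Fintype.card F : ℝ) ≠ 0 := by exact_mod_cast Fintype.card_ne_zero
  have hsum : ∑ t, (#(areaPairs E t) : ℝ) = (#E : ℝ) ^ 2 := by
    have : ∑ t, #(areaPairs E t) = #E ^ 2 := by
      simp_rw [card_areaPairs]
      rw [Finset.sum_comm]
      simp [sum_card_areaLine, sq]
    exact_mod_cast this
  have h1 : ∑ t, ((#(areaPairs E t) : ℝ) - (#E : ℝ) ^ 2 / Fintype.card F) ^ 2 =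
      ∑ t, (#(areaPairs E t) : ℝ) ^ 2 - (#E : ℝ) ^ 4 / Fintype.card F := by
    simp only [sub_sq, Finset.sum_add_distrib, Finset.sum_sub_distrib, ← Finset.sum_mul,
      ← Finset.mul_sum, hsum, Finset.sum_const, Finset.card_univ, nsmul_eq_mul]
    field_simp
    ring
  have h2 : ∀ t, ((#(areaPairs E t) : ℝ) - (#E : ℝ) ^ 2 / Fintype.card F) ^ 2 ≤
      #E * ∑ x ∈ E, ((#(areaLine E x t) : ℝ) - #E / Fintype.card F) ^ 2 := by
    intro t
    have : (#(areaPairs E t) : ℝ) - (#E : ℝ) ^ 2 / Fintype.card F =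
        ∑ x ∈ E, ((#(areaLine E x t) : ℝ) - #E / Fintype.card F) := by
      rw [card_areaPairs]
      push_cast
      rw [Finset.sum_sub_distrib, Finset.sum_const, nsmul_eq_mul]
      ring
    rw [this]
    exact sq_sum_le_card_mul_sum_sq
  have h3 : ∑ t, ((#(areaPairs E t) : ℝ) - (#E : ℝ) ^ 2 / Fintype.card F) ^ 2 ≤
      #E * ((Fintype.card F : ℝ) ^ 2 * #E) := by
    refine (Finset.sum_le_sum fun t _ => h2 t).trans ?_
    rw [← Finset.mul_sum, Finset.sum_comm]
    refine mul_le_mul_of_nonneg_left (le_trans ?_ (sum_sq_sub_areaLine_le E)) (by positivity)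
    exact Finset.sum_le_sum_of_subset_of_nonneg (Finset.subset_univ _)
      fun x _ _ => Finset.sum_nonneg fun t _ => sq_nonneg _
  nlinarith

lemma sum_sq_sub_card_stay_le {E : Finset (Fin 2 → F)} (hE : 0 ∉ E) :
    ∑ g, ((#(stay E g) : ℝ) - (#E : ℝ) ^ 2 / (Fintype.card F : ℝ) ^ 2) ^ 2 ≤
      2 * (Fintype.card F : ℝ) ^ 2 * (#E : ℝ) ^ 2 := by
  have hq : (0 : ℝ) < Fintype.card F := by exact_mod_cast Fintype.card_pos
  set μ : ℝ := (#E : ℝ) ^ 2 / (Fintype.card F : ℝ) ^ 2 with hμ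
  have h1 : (Fintype.card F : ℝ) * (#E : ℝ) ^ 2 ≤ ∑ g, (#(stay E g) : ℝ) := by
    exact_mod_cast card_mul_sq_le_sum_card_stay hE
  have h2 : ∑ g, (#(stay E g) : ℝ) ^ 2 ≤
      ∑ t, (#(areaPairs E t) : ℝ) ^ 2 + (Fintype.card F : ℝ) ^ 2 * (#E : ℝ) ^ 2 := by
    exact_mod_cast sum_card_stay_sq_le hE
  have h3 : (Fintype.card (SpecialLinearGroup (Fin 2) F) : ℝ) ≤ (Fintype.card F : ℝ) ^ 3 := by
    exact_mod_cast card_specialLinearGroup_le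
  have h4 := sum_card_areaPairs_sq_le E
  have h5 : ∑ g, ((#(stay E g) : ℝ) - μ) ^ 2 = ∑ g, (#(stay E g) : ℝ) ^ 2 -
      2 * μ * ∑ g, (#(stay E g) : ℝ) +
      μ ^ 2 * Fintype.card (SpecialLinearGroup (Fin 2) F) := by
    simp only [sub_sq, Finset.sum_add_distrib, Finset.sum_sub_distrib, ← Finset.sum_mul,
      ← Finset.mul_sum, Finset.sum_const, Finset.card_univ, nsmul_eq_mul]
    ring
  have hμ0 : 0 ≤ μ := by positivity
  have h6 := mul_le_mul_of_nonneg_left h1 hμ0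
  have h7 := mul_le_mul_of_nonneg_left h3 (sq_nonneg μ)
  have h8 : μ * ((Fintype.card F : ℝ) * (#E : ℝ) ^ 2) = (#E : ℝ) ^ 4 / Fintype.card F := by
    rw [hμ]; field_simp
  have h9 : μ ^ 2 * (Fintype.card F : ℝ) ^ 3 = (#E : ℝ) ^ 4 / Fintype.card F := by
    rw [hμ]; field_simp
  rw [h5]
  linarith

lemma sum_card_stay_pow_le {E : Finset (Fin 2 → F)} (hE : 0 ∉ E) (m : ℕ)
    (hcard : (Fintype.card F : ℝ) ^ (2 * m + 3) ≤ (#E : ℝ) ^ (m + 2)) :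
    (Fintype.card F : ℝ) ^ (2 * m + 1) * ∑ g, (#(stay E g) : ℝ) ^ (m + 2) ≤
      3 * 2 ^ (m + 1) * ((#E : ℝ) ^ (m + 2)) ^ 2 := by
  have hq : (0 : ℝ) < Fintype.card F := by exact_mod_cast Fintype.card_pos
  have hV := sum_sq_sub_card_stay_le hE
  set μ : ℝ := (#E : ℝ) ^ 2 / (Fintype.card F : ℝ) ^ 2 with hμ
  have hμ0 : 0 ≤ μ := by positivity
  have hμE : μ ≤ #E := by
    have h : (#E : ℝ) ≤ (Fintype.card F : ℝ) ^ 2 := by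
      have := Finset.card_le_univ E
      rw [Fintype.card_fun, Fintype.card_fin] at this
      exact_mod_cast this
    rw [hμ, div_le_iff₀ (by positivity), sq]
    exact mul_le_mul_of_nonneg_left h (by positivity)
  have hG : (Fintype.card (SpecialLinearGroup (Fin 2) F) : ℝ) ≤ (Fintype.card F : ℝ) ^ 3 := by
    exact_mod_cast card_specialLinearGroup_le
  have h1 : ∀ g, (#(stay E g) : ℝ) ^ (m + 2) ≤ 2 ^ (m + 1) *
      (μ ^ (m + 2) + (#E : ℝ) ^ m * ((#(stay E g) : ℝ) - μ) ^ 2) := by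
    intro g
    have hr : (#(stay E g) : ℝ) ≤ #E := by exact_mod_cast Finset.card_filter_le _ _
    have hr0 : (0 : ℝ) ≤ #(stay E g) := by positivity
    have habs : |(#(stay E g) : ℝ) - μ| ≤ #E := abs_le.mpr ⟨by linarith, by linarith⟩
    calc (#(stay E g) : ℝ) ^ (m + 2) ≤ (μ + |(#(stay E g) : ℝ) - μ|) ^ (m + 2) := by
          gcongr
          linarith [le_abs_self ((#(stay E g) : ℝ) - μ)]
      _ ≤ 2 ^ (m + 1) * (μ ^ (m + 2) + |(#(stay E g) : ℝ) - μ| ^ (m + 2)) :=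
          add_pow_le hμ0 (abs_nonneg _) _
      _ ≤ _ := by
          rw [pow_add |(#(stay E g) : ℝ) - μ|, sq_abs]
          gcongr
  have h2 : ∑ g, (#(stay E g) : ℝ) ^ (m + 2) ≤ 2 ^ (m + 1) *
      ((Fintype.card F : ℝ) ^ 3 * μ ^ (m + 2) +
        (#E : ℝ) ^ m * (2 * (Fintype.card F : ℝ) ^ 2 * (#E : ℝ) ^ 2)) := by
    refine (Finset.sum_le_sum fun g _ => h1 g).trans ?_
    rw [← Finset.mul_sum, Finset.sum_add_distrib, ← Finset.mul_sum, Finset.sum_const,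
      Finset.card_univ, nsmul_eq_mul]
    gcongr
  have h3 : (Fintype.card F : ℝ) ^ (2 * m + 1) * ((Fintype.card F : ℝ) ^ 3 * μ ^ (m + 2)) =
      ((#E : ℝ) ^ (m + 2)) ^ 2 := by
    rw [hμ, div_pow]
    field_simp
    ring
  calc _ ≤ (Fintype.card F : ℝ) ^ (2 * m + 1) * (2 ^ (m + 1) *
      ((Fintype.card F : ℝ) ^ 3 * μ ^ (m + 2) +
        (#E : ℝ) ^ m * (2 * (Fintype.card F : ℝ) ^ 2 * (#E : ℝ) ^ 2))) := by gcongr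
    _ = 2 ^ (m + 1) * (((#E : ℝ) ^ (m + 2)) ^ 2 +
        2 * (Fintype.card F : ℝ) ^ (2 * m + 3) * (#E : ℝ) ^ (m + 2)) := by
        rw [← h3]; ring
    _ ≤ 2 ^ (m + 1) * (((#E : ℝ) ^ (m + 2)) ^ 2 +
        2 * (#E : ℝ) ^ (m + 2) * (#E : ℝ) ^ (m + 2)) := by gcongr
    _ = _ := by ring

/-- Tuples of points of `E` whose first two points are independent. -/
def goodTuples (E : Finset (Fin 2 → F)) (m : ℕ) : Finset (Fin (m + 2) → Fin 2 → F) :=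
  {x ∈ Fintype.piFinset fun _ => E | area (x 0) (x 1) ≠ 0}

lemma pow_le_card_goodTuples_add {E : Finset (Fin 2 → F)} (hE : 0 ∉ E) (m : ℕ) :
    #E ^ (m + 2) ≤ #(goodTuples E m) + Fintype.card F * #E ^ (m + 1) := by
  have h1 : #E ^ (m + 2) = #(Fintype.piFinset fun _ : Fin (m + 2) => E) := by simp
  rw [h1, ← Finset.card_filter_add_card_filter_not
    (s := Fintype.piFinset fun _ : Fin (m + 2) => E) (fun x => area (x 0) (x 1) ≠ 0)]
  refine Nat.add_le_add le_rfl ?_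
  have := Finset.card_le_mul_card_image_of_maps_to
    (s := {x ∈ Fintype.piFinset fun _ : Fin (m + 2) => E | ¬ area (x 0) (x 1) ≠ 0})
    (t := Fintype.piFinset fun _ : Fin (m + 1) => E)
    (f := fun x => Fin.removeNth 1 x) ?_ (Fintype.card F) ?_
  · simpa using this
  · intro x hx
    simp only [mem_filter, Fintype.mem_piFinset] at hx ⊢
    exact fun i => hx.1 _
  · intro w hw
    have hw0 : w 0 ≠ 0 := ne_of_mem_of_not_mem (Fintype.mem_piFinset.mp hw 0) hE
    refine le_trans (Finset.card_le_card_of_injOn (fun x => x 1) ?_ ?_) (card_area_eq_le hw0 0)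
    · intro x hx
      simp only [coe_filter, mem_filter, Set.mem_ofPred_eq, not_not] at hx
      have : x 0 = w 0 := by
        rw [← hx.2]
        simp [Fin.removeNth]
      simpa [← this] using hx.1.2
    · intro x hx y hy (hxy : x 1 = y 1)
      simp only [coe_filter, mem_filter, Set.mem_ofPred_eq] at hx hy
      rw [← Fin.insertNth_self_removeNth 1 x, ← Fin.insertNth_self_removeNth 1 y, hx.2, hy.2, hxy]

/-- The matrix of pairwise areas of a tuple. -/
def areaMatrix {m : ℕ} (x : Fin (m + 2) → Fin 2 → F) : Fin (m + 2) → Fin (m + 2) → F :=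
  fun i j => area (x i) (x j)

lemma sum_card_fiber_sq_le (E : Finset (Fin 2 → F)) (m : ℕ) :
    ∑ f ∈ (goodTuples E m).image areaMatrix, #{x ∈ goodTuples E m | areaMatrix x = f} ^ 2 ≤
      ∑ g, #(stay E g) ^ (m + 2) := by
  have h1 : ∑ g, #(stay E g) ^ (m + 2) =
      #(univ.sigma fun g => Fintype.piFinset fun _ : Fin (m + 2) => stay E g) := by simp
  have h2 : ∑ f ∈ (goodTuples E m).image areaMatrix,
      #{x ∈ goodTuples E m | areaMatrix x = f} ^ 2 =
      #(((goodTuples E m).image areaMatrix).sigma fun f =>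
        {x ∈ goodTuples E m | areaMatrix x = f} ×ˢ {x ∈ goodTuples E m | areaMatrix x = f}) := by
    simp [sq]
  rw [h1, h2]
  refine Finset.card_le_card_of_surjOn
    (fun p => ⟨areaMatrix p.2, p.2, fun i => p.1.1 *ᵥ p.2 i⟩) ?_
  rintro ⟨f, x, y⟩ hp
  simp only [coe_sigma, Set.mem_sigma_iff, coe_product, Set.mem_prod, mem_coe, mem_filter] at hp
  obtain ⟨_, ⟨hx, rfl⟩, hy, hyx⟩ := hp
  simp only [goodTuples, mem_filter, Fintype.mem_piFinset] at hx hy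
  have hyx' : ∀ i j, area (y i) (y j) = area (x i) (x j) := fun i j => congrFun₂ hyx i j
  obtain ⟨g, hg0, hg1⟩ := exists_mulVec_eq hx.2 (hyx' 0 1)
  have hg : ∀ i, g.1 *ᵥ x i = y i := by
    intro i
    refine eq_of_area_eq hy.2 ?_ ?_
    · rw [hyx', ← hg0, area_mulVec]
    · rw [hyx', ← hg1, area_mulVec]
  refine ⟨⟨g, x⟩, ?_, ?_⟩
  · simp only [stay, coe_sigma, Set.mem_sigma_iff, mem_coe, mem_univ, true_and,
      Fintype.mem_piFinset, mem_filter, hg]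
    exact fun i => ⟨hx.1 i, hy.1 i⟩
  · simp only [hg]

lemma card_goodTuples_sq_le (E : Finset (Fin 2 → F)) (m : ℕ) :
    #(goodTuples E m) ^ 2 ≤
      #((goodTuples E m).image areaMatrix) * ∑ g, #(stay E g) ^ (m + 2) := by
  rw [Finset.card_eq_sum_card_image areaMatrix (goodTuples E m)]
  exact sq_sum_le_card_mul_sum_sq.trans (Nat.mul_le_mul_left _ (sum_card_fiber_sq_le E m))

lemma pow_le_card_image_areaMatrix {E : Finset (Fin 2 → F)} (hE : 0 ∉ E) (m : ℕ)
    (hcard : (Fintype.card F : ℝ) ^ (2 * m + 3) ≤ (#E : ℝ) ^ (m + 2))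
    (hcard' : 2 * (Fintype.card F : ℝ) ≤ #E) :
    (Fintype.card F : ℝ) ^ (2 * m + 1) ≤
      12 * 2 ^ (m + 1) * #((goodTuples E m).image areaMatrix) := by
  have hq : (0 : ℝ) < Fintype.card F := by exact_mod_cast Fintype.card_pos
  have hE0 : (0 : ℝ) < #E := by linarith
  have h1 : (#E : ℝ) ^ (m + 2) ≤ #(goodTuples E m) + Fintype.card F * (#E : ℝ) ^ (m + 1) := by
    exact_mod_cast pow_le_card_goodTuples_add hE m
  have h2 : ((#(goodTuples E m) : ℕ) : ℝ) ^ 2 ≤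
      #((goodTuples E m).image areaMatrix) * ∑ g, (#(stay E g) : ℝ) ^ (m + 2) := by
    exact_mod_cast card_goodTuples_sq_le E m
  have h3 := sum_card_stay_pow_le hE m hcard
  have h4 : (#E : ℝ) ^ (m + 2) ≤ 2 * #(goodTuples E m) := by
    have : 2 * (Fintype.card F : ℝ) * (#E : ℝ) ^ (m + 1) ≤ #E * (#E : ℝ) ^ (m + 1) := by gcongr
    have h5 : (#E : ℝ) ^ (m + 2) = #E * (#E : ℝ) ^ (m + 1) := by ring
    linarith
  set A : ℝ := (#E : ℝ) ^ (m + 2)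
  set N : ℝ := ((#((goodTuples E m).image areaMatrix) : ℕ) : ℝ)
  set S : ℝ := ∑ g, (#(stay E g) : ℝ) ^ (m + 2)
  have hA : 0 < A := by positivity
  have h6 : A ^ 2 ≤ 4 * (N * S) := by
    have : A ^ 2 ≤ (2 * #(goodTuples E m)) ^ 2 := by gcongr
    linarith
  refine le_of_mul_le_mul_right ?_ (pow_pos hA 2)
  calc (Fintype.card F : ℝ) ^ (2 * m + 1) * A ^ 2
      ≤ (Fintype.card F : ℝ) ^ (2 * m + 1) * (4 * (N * S)) := by gcongr
    _ = 4 * N * ((Fintype.card F : ℝ) ^ (2 * m + 1) * S) := by ring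
    _ ≤ 4 * N * (3 * 2 ^ (m + 1) * A ^ 2) := by gcongr
    _ = _ := by ring

end AreaCounting

/-- Main theorem over finite fields: for every `k ≥ 1` there are constants `C, c > 0` such
that for any finite field of odd order `q` and any `E ⊆ F_q²` with
`|E| ≥ C q^{2 - 1/(k+1)}`, the tuples from `E` determine at least `c q^{2k-1}` equivalence
classes, where tuples are equivalent iff all pairwise areas `xⁱ · (xʲ)^⊥` agree. -/
theorem positive_proportion_classes_finite_field (k : ℕ) (hk : 1 ≤ k) :
    ∃ C c : ℝ, 0 < C ∧ 0 < c ∧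
      ∀ (F : Type) [Field F] [Fintype F], ∀ (q p n : ℕ), p.Prime → Odd p → 1 ≤ n →
        q = p ^ n → Fintype.card F = q →
        ∀ E : Finset (Fin 2 → F),
          (C * (q : ℝ) ^ ((2 : ℝ) - 1 / (k + 1)) ≤ (E.card : ℝ)) →
          c * (q : ℝ) ^ (2 * k - 1 : ℕ) ≤
            (Nat.card {f : Fin (k + 1) → Fin (k + 1) → F //
                ∃ x : Fin (k + 1) → Fin 2 → F, (∀ i, x i ∈ E) ∧
                  ∀ i j, x i 0 * x j 1 - x i 1 * x j 0 = f i j} : ℝ) := by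
  obtain ⟨m, rfl⟩ : ∃ m, k = m + 1 := ⟨k - 1, by omega⟩
  refine ⟨4, 1 / (12 * 2 ^ (m + 1)), by norm_num, by positivity, ?_⟩
  intro F _ _ q p n _ _ _ _ hFq E hE
  classical
  subst hFq
  set q : ℝ := (Fintype.card F : ℝ)
  have hq : 1 ≤ q := Nat.one_le_cast.mpr Fintype.card_pos
  have hexp : (2 : ℝ) - 1 / ((m + 1 : ℕ) + 1) = (2 * m + 3 : ℕ) / (m + 2 : ℕ) := by
    push_cast
    field_simp
    ring
  rw [hexp] at hE
  set Q : ℝ := q ^ (((2 * m + 3 : ℕ) : ℝ) / (m + 2 : ℕ))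
  have hqQ : q ≤ Q := by
    refine Real.self_le_rpow_of_one_le hq ?_
    rw [one_le_div (by positivity)]
    exact_mod_cast (by omega : m + 2 ≤ 2 * m + 3)
  have hQ : Q ^ (m + 2) = q ^ (2 * m + 3) := by
    rw [← Real.rpow_natCast, ← Real.rpow_mul (by linarith), div_mul_cancel₀ _ (by positivity),
      Real.rpow_natCast]
  have hE' : 2 * Q ≤ #(E.erase 0) := by
    have : #E ≤ #(E.erase 0) + 1 := by
      have := Finset.pred_card_le_card_erase (s := E) (a := 0)
      omega
    have : (#E : ℝ) ≤ #(E.erase 0) + 1 := by exact_mod_cast this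
    linarith
  have hmain := pow_le_card_image_areaMatrix (Finset.notMem_erase 0 E) m
    (by rw [← hQ]; gcongr; linarith) (by linarith)
  have hcard : #((goodTuples (E.erase 0) m).image areaMatrix) ≤
      Nat.card {f : Fin (m + 1 + 1) → Fin (m + 1 + 1) → F //
        ∃ x : Fin (m + 1 + 1) → Fin 2 → F, (∀ i, x i ∈ E) ∧
          ∀ i j, x i 0 * x j 1 - x i 1 * x j 0 = f i j} := by
    rw [Nat.card_eq_fintype_card, Fintype.card_subtype]
    refine Finset.card_le_card fun f hf => ?_
    obtain ⟨x, hx, rfl⟩ := Finset.mem_image.mp hf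
    simp only [goodTuples, mem_filter, Fintype.mem_piFinset] at hx
    exact Finset.mem_filter.mpr
      ⟨Finset.mem_univ _, x, fun i => Finset.mem_of_mem_erase (hx.1 i), fun i j => rfl⟩
  have hcard' : ((#((goodTuples (E.erase 0) m).image areaMatrix) : ℕ) : ℝ) ≤ _ :=
    Nat.cast_le.mpr hcard
  rw [show 2 * (m + 1) - 1 = 2 * m + 1 by omega, one_div, inv_mul_le_iff₀ (by positivity)]
  exact hmain.trans (mul_le_mul_of_nonneg_left hcard' (by positivity))
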